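/- For every real a > 1 and every real t, one has ∑_{x < p ≤ ax} 1/p − (log log(ax) − log log x) = O((log x)^{−t}) as x → ∞, where the sum is over primes p with x < p ≤ ax. (Note log log(ax) − log log x = log(1 + 1/log_a x).) -/

import Mathlib

open Filter

open scoped Classical in
/-- `primeSumIoc l u = ∑_{l < p ≤ u} 1/p`, the sum over primes `p` with `l < p ≤ u`. -/
noncomputable def primeSumIoc (l u : ℝ) : ℝ :=
  ∑ p ∈ (Finset.range (⌊u⌋₊ + 1)).filter (fun p => Nat.Prime p ∧ l < (p : ℝ) ∧ (p : ℝ) ≤ u),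
    1 / (p : ℝ)

/-- `(s - 1)` times the difference between `(n + 1) ^ (-s)` and `∫ x ^ (-s)` over
`[n + 1, n + 2]`. -/
noncomputable def zetaDefect (n : ℕ) (s : ℂ) : ℂ :=
  (s - 1) * ((n : ℂ) + 1) ^ (-s) + (((n : ℂ) + 2) ^ (1 - s) - ((n : ℂ) + 1) ^ (1 - s))

lemma norm_ofReal_cpow_neg_sub_le {a x : ℝ} {s : ℂ} (ha : 0 < a) (hx : x ∈ Set.Icc a (a + 1))
    (hs : 0 < s.re) :
    ‖(x : ℂ) ^ (-s) - (a : ℂ) ^ (-s)‖ ≤ ‖s‖ * a ^ (-s.re - 1) := by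
  have hs0 : -s ≠ 0 := by
    intro h
    have : s = 0 := by simpa using h
    simp [this] at hs
  have key := norm_image_sub_le_of_norm_deriv_le_segment' (a := a) (b := a + 1)
    (f := fun y : ℝ => (y : ℂ) ^ (-s)) (f' := fun y : ℝ => -s * (y : ℂ) ^ (-s - 1))
    (C := ‖s‖ * a ^ (-s.re - 1))
    (fun y hy => (hasDerivAt_ofReal_cpow_const (by linarith [hy.1]) hs0).hasDerivWithinAt)
    (fun y hy => by
      have hy0 : 0 < y := by linarith [hy.1]
      rw [norm_mul, norm_neg, Complex.norm_cpow_eq_rpow_re_of_pos hy0]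
      have : (-s - 1).re = -s.re - 1 := by simp
      rw [this]
      gcongr ‖s‖ * ?_
      exact Real.rpow_le_rpow_of_nonpos ha hy.1 (by linarith)) x hx
  refine key.trans ?_
  have : x - a ≤ 1 := by linarith [hx.2]
  have h0 : 0 ≤ ‖s‖ * a ^ (-s.re - 1) := by positivity
  nlinarith

lemma norm_ofReal_cpow_neg_sub_le_two_mul {a x : ℝ} {s : ℂ} (ha : 0 < a) (hx : a ≤ x)
    (hs : 0 < s.re) :
    ‖(x : ℂ) ^ (-s) - (a : ℂ) ^ (-s)‖ ≤ 2 * a ^ (-s.re) := by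
  have h1 : ‖(x : ℂ) ^ (-s)‖ ≤ a ^ (-s.re) := by
    rw [Complex.norm_cpow_eq_rpow_re_of_pos (by linarith)]
    exact Real.rpow_le_rpow_of_nonpos ha hx (by simpa using hs.le)
  have h2 : ‖(a : ℂ) ^ (-s)‖ = a ^ (-s.re) := by
    rw [Complex.norm_cpow_eq_rpow_re_of_pos ha]; simp
  linarith [norm_sub_le ((x : ℂ) ^ (-s)) ((a : ℂ) ^ (-s))]

lemma norm_zetaDefect_le_of_bound {n : ℕ} {s : ℂ} {B : ℝ}
    (hB : ∀ x ∈ Set.Icc ((n : ℝ) + 1) (n + 1 + 1),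
      ‖(x : ℂ) ^ (-s) - ((n + 1 : ℝ) : ℂ) ^ (-s)‖ ≤ B) :
    ‖zetaDefect n s‖ ≤ ‖s - 1‖ * B := by
  rcases eq_or_ne s 1 with rfl | hs1
  · simp [zetaDefect]
  have h1s : 1 - s ≠ 0 := sub_ne_zero.2 hs1.symm
  have hn : (0 : ℝ) < n + 1 := by positivity
  have key := norm_image_sub_le_of_norm_deriv_le_segment' (a := (n : ℝ) + 1) (b := n + 1 + 1)
    (f := fun y : ℝ => (s - 1) * ((n + 1 : ℝ) : ℂ) ^ (-s) * y + (y : ℂ) ^ (1 - s))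
    (f' := fun y : ℝ => (s - 1) * ((n + 1 : ℝ) : ℂ) ^ (-s) * 1 + (1 - s) * (y : ℂ) ^ (1 - s - 1))
    (C := ‖s - 1‖ * B)
    (fun y hy => by
      refine HasDerivAt.hasDerivWithinAt (HasDerivAt.add ?_ ?_)
      · exact (Complex.ofRealCLM.hasDerivAt (x := y)).const_mul _
      · exact hasDerivAt_ofReal_cpow_const (by linarith [hy.1]) h1s)
    (fun y hy => by
      have : (s - 1) * ((n + 1 : ℝ) : ℂ) ^ (-s) * 1 + (1 - s) * (y : ℂ) ^ (1 - s - 1)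
          = -((s - 1) * ((y : ℂ) ^ (-s) - ((n + 1 : ℝ) : ℂ) ^ (-s))) := by
        rw [show 1 - s - 1 = -s by ring]; ring
      rw [this, norm_neg, norm_mul]
      gcongr
      exact hB y ⟨hy.1, hy.2.le⟩) (n + 1 + 1) ⟨by linarith, le_rfl⟩
  have e : (n : ℝ) + 1 + 1 - (n + 1) = 1 := by ring
  rw [e, mul_one] at key
  refine le_trans (le_of_eq ?_) key
  congr 1
  unfold zetaDefect
  push_cast
  rw [show (n : ℂ) + 1 + 1 = n + 2 by ring]
  ring

lemma norm_zetaDefect_le (n : ℕ) {s : ℂ} (hs : 0 < s.re) {θ : ℝ} (h0 : 0 ≤ θ) (h1 : θ ≤ 1) :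
    ‖zetaDefect n s‖ ≤ 2 * ‖s - 1‖ * ‖s‖ ^ θ * ((n : ℝ) + 1) ^ (-s.re - θ) := by
  have hn : (0 : ℝ) < n + 1 := by positivity
  have hspos : 0 < ‖s‖ := lt_of_lt_of_le hs (Complex.re_le_norm s)
  have e : ((n : ℝ) + 1) ^ (-s.re - θ) = ((n : ℝ) + 1) ^ (-s.re) / ((n : ℝ) + 1) ^ θ :=
    Real.rpow_sub hn _ _
  have hA : 0 < ((n : ℝ) + 1) ^ (-s.re) := by positivity
  have e2 : ‖s‖ ^ θ * (((n : ℝ) + 1) ^ (-s.re) / ((n : ℝ) + 1) ^ θ)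
      = ((n : ℝ) + 1) ^ (-s.re) * (‖s‖ / (n + 1)) ^ θ := by
    rw [Real.div_rpow hspos.le hn.le]; ring
  rw [show 2 * ‖s - 1‖ * ‖s‖ ^ θ * ((n : ℝ) + 1) ^ (-s.re - θ)
    = ‖s - 1‖ * (2 * (‖s‖ ^ θ * ((n : ℝ) + 1) ^ (-s.re - θ))) by ring, e, e2]
  rcases le_total 1 (‖s‖ / (n + 1)) with h | h
  · refine norm_zetaDefect_le_of_bound fun x hx =>
      (norm_ofReal_cpow_neg_sub_le_two_mul hn hx.1 hs).trans ?_
    have : 1 ≤ (‖s‖ / (n + 1)) ^ θ := Real.one_le_rpow h h0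
    nlinarith
  · refine norm_zetaDefect_le_of_bound fun x hx =>
      (norm_ofReal_cpow_neg_sub_le hn hx hs).trans ?_
    have h2 : ‖s‖ / (n + 1) ≤ (‖s‖ / (n + 1)) ^ θ := by
      simpa using Real.rpow_le_rpow_of_exponent_ge (by positivity) h h1
    rw [Real.rpow_sub_one hn.ne']
    calc ‖s‖ * (((n : ℝ) + 1) ^ (-s.re) / (n + 1))
        = ((n : ℝ) + 1) ^ (-s.re) * (‖s‖ / (n + 1)) := by ring
      _ ≤ ((n : ℝ) + 1) ^ (-s.re) * (‖s‖ / (n + 1)) ^ θ := by gcongr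
      _ ≤ _ := by
        have : 0 ≤ ((n : ℝ) + 1) ^ (-s.re) * (‖s‖ / (n + 1)) ^ θ := by positivity
        linarith

lemma differentiable_zetaDefect (n : ℕ) : Differentiable ℂ (zetaDefect n) := by
  have h1 : (n : ℂ) + 1 ≠ 0 := by exact_mod_cast Nat.succ_ne_zero n
  have h2 : (n : ℂ) + 2 ≠ 0 := by exact_mod_cast Nat.succ_ne_zero (n + 1)
  unfold zetaDefect
  intro s
  refine DifferentiableAt.add (DifferentiableAt.mul (by fun_prop) ?_)
    (DifferentiableAt.sub ?_ ?_)
  · exact DifferentiableAt.const_cpow (by fun_prop) (Or.inl h1)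
  · exact DifferentiableAt.const_cpow (by fun_prop) (Or.inl h2)
  · exact DifferentiableAt.const_cpow (by fun_prop) (Or.inl h1)

lemma summable_nat_add_one_rpow {p : ℝ} (hp : p < -1) :
    Summable fun n : ℕ => ((n : ℝ) + 1) ^ p := by
  have := (summable_nat_add_iff 1).2 (Real.summable_nat_rpow.2 hp)
  simpa using this

lemma hasSum_zetaDefect_of_one_lt_re {s : ℂ} (hs : 1 < s.re) :
    HasSum (fun n => zetaDefect n s) (riemannZeta₁ s - 1) := by
  have hs1 : s ≠ 1 := by rintro rfl; simp at hs
  have hz : HasSum (fun n : ℕ => 1 / ((n : ℂ) + 1) ^ s) (riemannZeta s) := by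
    rw [zeta_eq_tsum_one_div_nat_add_one_cpow hs]
    refine Summable.hasSum ?_
    have := (summable_nat_add_iff 1).2 (Complex.summable_one_div_nat_cpow.2 hs)
    simpa using this
  have hsum : Summable fun n => zetaDefect n s := by
    refine Summable.of_norm_bounded
      (g := fun n : ℕ => 2 * ‖s - 1‖ * ‖s‖ ^ (0 : ℝ) * ((n : ℝ) + 1) ^ (-s.re - 0))
      ((summable_nat_add_one_rpow (by linarith)).mul_left _)
      fun n => norm_zetaDefect_le n (by linarith) le_rfl zero_le_one
  rw [hsum.hasSum_iff_tendsto_nat]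
  have hpart : ∀ N : ℕ, ∑ n ∈ Finset.range N, zetaDefect n s
      = (s - 1) * (∑ n ∈ Finset.range N, 1 / ((n : ℂ) + 1) ^ s)
        + (((N : ℂ) + 1) ^ (1 - s) - 1) := by
    intro N
    induction N with
    | zero => simp
    | succ N ih =>
      rw [Finset.sum_range_succ, ih, Finset.sum_range_succ, zetaDefect, Complex.cpow_neg]
      push_cast
      rw [show (N : ℂ) + 1 + 1 = N + 2 by ring]
      ring
  simp_rw [hpart]
  have hlim : Tendsto (fun N : ℕ => ((N : ℂ) + 1) ^ (1 - s)) atTop (nhds 0) := by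
    rw [tendsto_zero_iff_norm_tendsto_zero]
    have h1 : Tendsto (fun N : ℕ => ((N : ℝ) + 1) ^ (-(s.re - 1))) atTop (nhds 0) :=
      (tendsto_rpow_neg_atTop (by linarith)).comp
        (tendsto_atTop_add_const_right _ _ tendsto_natCast_atTop_atTop)
    refine h1.congr fun N => ?_
    have := Complex.norm_cpow_eq_rpow_re_of_pos (x := (N : ℝ) + 1) (by positivity) (1 - s)
    push_cast at this
    rw [this]
    simp
  have := (hz.tendsto_sum_nat.const_mul (s - 1)).add (hlim.sub_const 1)
  convert this using 2
  rw [riemannZeta_eq_inv_sub_mul hs1, ← mul_assoc, mul_inv_cancel₀ (sub_ne_zero.2 hs1)]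
  ring

lemma riemannZeta₁_eq_one_add_tsum {s : ℂ} (hs : 1 / 2 < s.re) :
    riemannZeta₁ s = 1 + ∑' n, zetaDefect n s := by
  set R : ℝ := ‖s‖ + 3 with hR
  set U : Set ℂ := {z : ℂ | 1 / 2 < z.re} ∩ Metric.ball 0 R with hU
  have hUo : IsOpen U := (isOpen_lt continuous_const Complex.continuous_re).inter Metric.isOpen_ball
  have hUc : Convex ℝ U := (convex_halfSpace_re_gt _).inter (convex_ball _ _)
  have hd : DifferentiableOn ℂ (fun z => 1 + ∑' n, zetaDefect n z) U := by
    refine DifferentiableOn.const_add _ ?_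
    refine Complex.differentiableOn_tsum_of_summable_norm
      (u := fun n : ℕ => 2 * (R + 1) * R ^ (1 : ℝ) * ((n : ℝ) + 1) ^ (-(1 / 2) - 1 : ℝ))
      ((summable_nat_add_one_rpow (by norm_num)).mul_left _)
      (fun n => (differentiable_zetaDefect n).differentiableOn) hUo ?_
    intro n z hz
    have hz1 : 1 / 2 < z.re := hz.1
    have hz2 : ‖z‖ ≤ R := by simpa using (Metric.mem_ball.1 hz.2).le
    refine (norm_zetaDefect_le n (by linarith) zero_le_one le_rfl).trans ?_
    gcongr
    · exact (norm_sub_le _ _).trans (by simpa using hz2)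
    · linarith [show (0 : ℝ) ≤ n from Nat.cast_nonneg n]
  have h2 : (2 : ℂ) ∈ U := ⟨by norm_num, by simp [hR]; linarith [norm_nonneg s]⟩
  have hsU : s ∈ U := ⟨hs, by simp [hR]⟩
  refine (differentiable_riemannZeta₁.differentiableOn.analyticOnNhd
    hUo).eqOn_of_preconnected_of_eventuallyEq (hd.analyticOnNhd hUo) hUc.isPreconnected h2 ?_ hsU
  have : ∀ᶠ z : ℂ in nhds 2, 1 < z.re :=
    (isOpen_lt continuous_const Complex.continuous_re).mem_nhds (by norm_num)
  filter_upwards [this] with z hz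
  rw [(hasSum_zetaDefect_of_one_lt_re hz).tsum_eq]
  ring

lemma exists_norm_riemannZeta₁_le {ε : ℝ} (h0 : 0 < ε) (h1 : ε < 1 / 2) :
    ∃ C : ℝ, 0 < C ∧ ∀ s : ℂ, 1 - ε ≤ s.re →
      ‖riemannZeta₁ s‖ ≤ 1 + C * ‖s - 1‖ * ‖s‖ ^ (2 * ε) := by
  have hsumm := summable_nat_add_one_rpow (p := -(1 + ε)) (by linarith)
  have hpos : 0 < ∑' n : ℕ, ((n : ℝ) + 1) ^ (-(1 + ε)) :=
    hsumm.tsum_pos (fun n => by positivity) 0 (by positivity)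
  refine ⟨2 * ∑' n : ℕ, ((n : ℝ) + 1) ^ (-(1 + ε)), by positivity, fun s hs => ?_⟩
  rw [riemannZeta₁_eq_one_add_tsum (by linarith)]
  refine (norm_add_le _ _).trans ?_
  rw [norm_one]
  gcongr
  have hb : ∀ n : ℕ, ‖zetaDefect n s‖
      ≤ 2 * ‖s - 1‖ * ‖s‖ ^ (2 * ε) * ((n : ℝ) + 1) ^ (-(1 + ε)) := fun n => by
    refine (norm_zetaDefect_le n (by linarith) (by linarith : 0 ≤ 2 * ε) (by linarith)).trans ?_
    gcongr
    · linarith [show (0 : ℝ) ≤ n from Nat.cast_nonneg n]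
    · linarith
  refine (tsum_of_norm_bounded (hsumm.mul_left _).hasSum hb).trans (le_of_eq ?_)
  rw [tsum_mul_left]
  ring

lemma exists_norm_riemannZeta_le {ε : ℝ} (h0 : 0 < ε) (h1 : ε ≤ 1 / 2) :
    ∃ C : ℝ, 1 ≤ C ∧ ∀ s : ℂ, 1 - ε / 2 ≤ s.re → s.re ≤ 4 → 1 / 2 ≤ |s.im| →
      ‖riemannZeta s‖ ≤ C * (1 + |s.im|) ^ ε := by
  obtain ⟨C, hC, h⟩ := exists_norm_riemannZeta₁_le (ε := ε / 2) (by linarith) (by linarith)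
  refine ⟨2 + 5 * C, by linarith, fun s hs1 hs2 ht => ?_⟩
  have hs : s ≠ 1 := by rintro rfl; norm_num at ht
  have hn : 1 / 2 ≤ ‖s - 1‖ := ht.trans (by simpa using Complex.abs_im_le_norm (s - 1))
  have hpos : 0 < ‖s - 1‖ := by linarith
  have h5 : ‖s‖ ≤ 5 * (1 + |s.im|) := by
    have := Complex.norm_le_abs_re_add_abs_im s
    rw [abs_of_nonneg (by linarith : 0 ≤ s.re)] at this
    linarith
  have hτ : 1 ≤ (1 + |s.im|) ^ ε := Real.one_le_rpow (by linarith) h0.le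
  rw [riemannZeta_eq_inv_sub_mul hs, norm_mul, norm_inv]
  calc ‖s - 1‖⁻¹ * ‖riemannZeta₁ s‖
      ≤ ‖s - 1‖⁻¹ * (1 + C * ‖s - 1‖ * ‖s‖ ^ (2 * (ε / 2))) := by gcongr; exact h s hs1
    _ = ‖s - 1‖⁻¹ + C * ‖s‖ ^ ε := by
        rw [mul_div_cancel₀ _ two_ne_zero]; field_simp
    _ ≤ 2 + C * (5 * (1 + |s.im|)) ^ ε := by
        gcongr
        rw [inv_le_comm₀ hpos (by norm_num)]; linarith
    _ ≤ 2 * (1 + |s.im|) ^ ε + C * (5 * (1 + |s.im|) ^ ε) := by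
        rw [Real.mul_rpow (by norm_num) (by linarith)]
        gcongr
        · linarith
        · calc (5 : ℝ) ^ ε ≤ 5 ^ (1 : ℝ) :=
                Real.rpow_le_rpow_of_exponent_le (by norm_num) (by linarith)
            _ = 5 := by norm_num
    _ = _ := by ring

lemma exists_norm_riemannZeta_and_deriv_le {ε : ℝ} (h0 : 0 < ε) (h1 : ε ≤ 1 / 2) :
    ∃ C : ℝ, 1 ≤ C ∧ ∀ s : ℂ, 1 - 1 / C ≤ s.re → s.re ≤ 3 → 1 ≤ |s.im| →
      ‖riemannZeta s‖ ≤ C * (1 + |s.im|) ^ ε ∧ ‖deriv riemannZeta s‖ ≤ C * (1 + |s.im|) ^ ε := by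
  obtain ⟨C, hC, h⟩ := exists_norm_riemannZeta_le h0 h1
  have hCC : C ≤ C * (8 / ε) := by
    have : 1 ≤ 8 / ε := by rw [le_div_iff₀ h0]; linarith
    nlinarith
  refine ⟨C * (8 / ε), by linarith, fun s hs1 hs2 ht => ?_⟩
  have hδ : 1 / (C * (8 / ε)) ≤ ε / 4 := by
    rw [div_le_iff₀ (by positivity)]
    field_simp
    linarith
  constructor
  · refine (h s (by linarith) (by linarith) (by linarith)).trans ?_
    gcongr
  · have hb : ∀ z ∈ Metric.closedBall s (ε / 4), 1 - ε / 2 ≤ z.re ∧ z.re ≤ 4 ∧ 1 / 2 ≤ |z.im| ∧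
        |z.im| ≤ |s.im| + 1 := by
      intro z hz
      rw [Metric.mem_closedBall, dist_eq_norm] at hz
      have hre := (Complex.abs_re_le_norm (z - s)).trans hz
      have him := (Complex.abs_im_le_norm (z - s)).trans hz
      rw [Complex.sub_re, abs_le] at hre
      rw [Complex.sub_im] at him
      have hi1 := abs_sub_abs_le_abs_sub z.im s.im
      have hi2 := abs_sub_abs_le_abs_sub s.im z.im
      rw [abs_sub_comm] at hi2
      refine ⟨by linarith [hre.1], by linarith [hre.2], by linarith, by linarith⟩
    have hd : DiffContOnCl ℂ riemannZeta (Metric.ball s (ε / 4)) := by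
      refine DifferentiableOn.diffContOnCl fun z hz => ?_
      have hz' := hb z (Metric.closure_ball_subset_closedBall hz)
      refine (differentiableAt_riemannZeta ?_).differentiableWithinAt
      rintro rfl
      norm_num at hz'
    refine (Complex.norm_deriv_le_of_forall_mem_sphere_norm_le (C := C * (2 * (1 + |s.im|) ^ ε))
      (by linarith) hd ?_).trans (le_of_eq ?_)
    · intro z hz
      obtain ⟨z1, z2, z3, z4⟩ := hb z (Metric.sphere_subset_closedBall hz)
      refine (h z z1 z2 z3).trans ?_
      gcongr
      calc (1 + |z.im|) ^ ε ≤ (2 * (1 + |s.im|)) ^ ε := by gcongr; linarith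
        _ = 2 ^ ε * (1 + |s.im|) ^ ε := Real.mul_rpow (by norm_num) (by positivity)
        _ ≤ 2 * (1 + |s.im|) ^ ε := by
          gcongr
          calc (2 : ℝ) ^ ε ≤ 2 ^ (1 : ℝ) :=
                Real.rpow_le_rpow_of_exponent_le (by norm_num) (by linarith)
            _ = 2 := by norm_num
    · field_simp
      norm_num

lemma exists_norm_riemannZeta_one_add_le :
    ∃ C : ℝ, 1 ≤ C ∧ ∀ η : ℝ, 0 < η → η ≤ 1 → ‖riemannZeta (1 + η)‖ ≤ C / η := by
  obtain ⟨C, hC, h⟩ := exists_norm_riemannZeta₁_le (ε := 1 / 4) (by norm_num) (by norm_num)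
  refine ⟨1 + 2 * C, by linarith, fun η h0 h1 => ?_⟩
  have hne : (1 + η : ℂ) ≠ 1 := by
    simpa using h0.ne'
  have hn : ‖(1 + η : ℂ)‖ ≤ 2 := by
    refine (norm_add_le _ _).trans ?_
    simp [abs_of_pos h0]; linarith
  have hsub : (1 + η : ℂ) - 1 = η := by ring
  have := h (1 + η) (by simp; linarith)
  rw [hsub, Complex.norm_real, Real.norm_of_nonneg h0.le] at this
  rw [riemannZeta_eq_inv_sub_mul hne, hsub, norm_mul, norm_inv, Complex.norm_real,
    Real.norm_of_nonneg h0.le, inv_mul_eq_div]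
  gcongr
  refine this.trans ?_
  have : ‖(1 + η : ℂ)‖ ^ (2 * (1 / 4) : ℝ) ≤ 2 := by
    calc ‖(1 + η : ℂ)‖ ^ (2 * (1 / 4) : ℝ) ≤ 2 ^ (2 * (1 / 4) : ℝ) := by gcongr
      _ ≤ 2 ^ (1 : ℝ) := Real.rpow_le_rpow_of_exponent_le (by norm_num) (by norm_num)
      _ = 2 := by norm_num
  have : C * η * ‖(1 + η : ℂ)‖ ^ (2 * (1 / 4) : ℝ) ≤ C * 1 * 2 := by gcongr
  linarith

lemma norm_riemannZeta_product_ge_one {x : ℝ} (hx : 0 < x) (y : ℝ) :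
    1 ≤ ‖riemannZeta (1 + x)‖ ^ 3 * ‖riemannZeta (1 + x + Complex.I * y)‖ ^ 4 *
      ‖riemannZeta (1 + x + 2 * Complex.I * y)‖ := by
  have := DirichletCharacter.norm_LFunction_product_ge_one (N := 1) 1 hx y
  simpa [DirichletCharacter.LFunctionTrivChar, DirichletCharacter.LFunction_modOne_eq] using this

lemma norm_riemannZeta_ge_of_forall_le {s : ℂ} {T : ℝ} (hT : 1 ≤ T) (hs1 : 1 ≤ s.re)
    (hs2 : s.re ≤ 2) (ht : 1 ≤ |s.im|)
    (hup : ∀ w : ℂ, 1 ≤ w.re → w.re ≤ 3 → 1 ≤ |w.im| → |w.im| ≤ 2 * |s.im| →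
      ‖riemannZeta w‖ ≤ T ∧ ‖deriv riemannZeta w‖ ≤ T)
    (hreal : ∀ η : ℝ, 0 < η → η ≤ 1 → ‖riemannZeta (1 + η)‖ ≤ T / η) :
    1 / (16 * T ^ 7) ≤ ‖riemannZeta s‖ := by
  set η₀ : ℝ := 1 / (16 * T ^ 8) with hη₀
  have hT0 : 0 < T := by linarith
  have hη₀pos : 0 < η₀ := by positivity
  have hη₀1 : η₀ ≤ 1 := by
    rw [hη₀, div_le_one (by positivity)]
    nlinarith [one_le_pow₀ hT (n := 8)]
  have step : ∀ η : ℝ, η₀ ≤ η → η ≤ 1 →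
      1 / (8 * T ^ 7) ≤ ‖riemannZeta (1 + η + Complex.I * s.im)‖ := by
    intro η h1 h2
    have hη : 0 < η := by linarith
    have hprod := norm_riemannZeta_product_ge_one hη s.im
    have hA := hreal η hη h2
    have hB := (hup (1 + η + 2 * Complex.I * s.im) (by simp; linarith) (by simp; linarith)
      (by simp [abs_mul]; linarith) (by simp [abs_mul])).1
    set X := ‖riemannZeta (1 + η + Complex.I * s.im)‖
    have h3 : 1 ≤ (T / η) ^ 3 * X ^ 4 * T := hprod.trans (by gcongr)
    have h4 : η ^ 3 / T ^ 4 ≤ X ^ 4 := by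
      rw [div_le_iff₀ (by positivity)]
      have : (T / η) ^ 3 * X ^ 4 * T = X ^ 4 * T ^ 4 / η ^ 3 := by field_simp
      rw [this, le_div_iff₀ (by positivity)] at h3
      linarith
    have h5 : (1 / (8 * T ^ 7)) ^ 4 ≤ X ^ 4 := by
      refine le_trans ?_ h4
      calc (1 / (8 * T ^ 7)) ^ 4 = η₀ ^ 3 / T ^ 4 := by rw [hη₀]; field_simp; norm_num
        _ ≤ η ^ 3 / T ^ 4 := by gcongr
    exact le_of_pow_le_pow_left₀ (by norm_num) (norm_nonneg _) h5
  have hsmall : 1 / (16 * T ^ 7) ≤ 1 / (8 * T ^ 7) := by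
    apply one_div_le_one_div_of_le (by positivity)
    nlinarith [pow_pos hT0 7]
  have hdecomp : ((s.re : ℂ) + Complex.I * s.im) = s := by
    rw [mul_comm]; exact Complex.re_add_im s
  rcases le_or_gt η₀ (s.re - 1) with h | h
  · have := step (s.re - 1) h (by linarith)
    push_cast at this
    rw [add_sub_cancel, hdecomp] at this
    linarith
  · have h1 := step η₀ le_rfl hη₀1
    set w : ℂ := 1 + η₀ + Complex.I * s.im with hw
    have hwre : w.re = 1 + η₀ := by simp [hw]
    have hwim : w.im = s.im := by simp [hw]
    have hconv : Convex ℝ (segment ℝ s w) := convex_segment _ _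
    have hseg : ∀ z ∈ segment ℝ s w, 1 ≤ z.re ∧ z.re ≤ 3 ∧ z.im = s.im := by
      rintro z ⟨a, b, ha, hb, hab, rfl⟩
      have hb' : b = 1 - a := by linarith
      subst hb'
      refine ⟨?_, ?_, ?_⟩
      · simp [hwre]; nlinarith
      · simp [hwre]; nlinarith
      · simp [hwim]; ring
    have hmv : ‖riemannZeta w - riemannZeta s‖ ≤ T * ‖w - s‖ := by
      refine hconv.norm_image_sub_le_of_norm_deriv_le (fun z hz => ?_) (fun z hz => ?_)
        (left_mem_segment _ _ _) (right_mem_segment _ _ _)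
      · refine differentiableAt_riemannZeta ?_
        rintro rfl
        have := (hseg 1 hz).2.2
        rw [← this] at ht
        norm_num at ht
      · obtain ⟨z1, z2, z3⟩ := hseg z hz
        exact (hup z z1 z2 (by rwa [z3]) (by rw [z3]; linarith)).2
    have hws : ‖w - s‖ ≤ η₀ := by
      have : w - s = ((1 + η₀ - s.re : ℝ) : ℂ) := by
        apply Complex.ext
        · simp [hwre]
        · simp [hwim]
      rw [this, Complex.norm_real, Real.norm_eq_abs, abs_le]
      constructor <;> linarith
    have h2 : T * ‖w - s‖ ≤ 1 / (16 * T ^ 7) := by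
      calc T * ‖w - s‖ ≤ T * η₀ := by gcongr
        _ = _ := by rw [hη₀]; field_simp
    have h3 : ‖riemannZeta w‖ ≤ ‖riemannZeta s‖ + ‖riemannZeta w - riemannZeta s‖ := by
      have := norm_add_le (riemannZeta s) (riemannZeta w - riemannZeta s)
      rwa [add_sub_cancel] at this
    have h4 : 1 / (8 * T ^ 7) = 1 / (16 * T ^ 7) + 1 / (16 * T ^ 7) := by field_simp; norm_num
    linarith

/-- A zero-free region of width comparable to `T⁻⁸`, where `T = C (1 + |Im s|) ^ ε`. -/
lemma exists_riemannZeta_bounds_on_closedBall {ε : ℝ} (h0 : 0 < ε) (h1 : ε ≤ 1 / 2) :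
    ∃ C : ℝ, 1 ≤ C ∧ ∀ s : ℂ, 1 ≤ s.re → s.re ≤ 2 → 2 ≤ |s.im| →
      ∀ T : ℝ, T = C * (1 + |s.im|) ^ ε → ∀ w ∈ Metric.closedBall s (1 / (32 * T ^ 8)),
        1 / (32 * T ^ 7) ≤ ‖riemannZeta w‖ ∧ ‖deriv riemannZeta w‖ ≤ T := by
  obtain ⟨C₁, hC₁, hup⟩ := exists_norm_riemannZeta_and_deriv_le h0 h1
  obtain ⟨C₂, hC₂, hreal⟩ := exists_norm_riemannZeta_one_add_le
  set C := max (2 * C₁) C₂ with hC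
  have hCC₁ : 2 * C₁ ≤ C := le_max_left _ _
  have hCC₂ : C₂ ≤ C := le_max_right _ _
  refine ⟨C, by linarith, ?_⟩
  rintro s hs1 hs2 ht T rfl
  set τ := (1 + |s.im|) ^ ε with hτdef
  have hτ : 1 ≤ τ := Real.one_le_rpow (by linarith) h0.le
  set T := C * τ with hTdef
  have hTC : C ≤ T := by nlinarith
  have hT : 1 ≤ T := by linarith
  have hT0 : 0 < T := by linarith
  have hT8 : T ≤ T ^ 8 := le_self_pow₀ hT (by norm_num)
  have hup' : ∀ w : ℂ, 1 - 1 / C₁ ≤ w.re → w.re ≤ 3 → 1 ≤ |w.im| → |w.im| ≤ 2 * |s.im| →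
      ‖riemannZeta w‖ ≤ T ∧ ‖deriv riemannZeta w‖ ≤ T := by
    intro w w1 w2 w3 w4
    have hb : C₁ * (1 + |w.im|) ^ ε ≤ T := by
      calc C₁ * (1 + |w.im|) ^ ε ≤ C₁ * (2 * (1 + |s.im|)) ^ ε := by gcongr; linarith
        _ = C₁ * (2 ^ ε * τ) := by rw [Real.mul_rpow (by norm_num) (by positivity)]
        _ ≤ C₁ * (2 * τ) := by
          gcongr
          calc (2 : ℝ) ^ ε ≤ 2 ^ (1 : ℝ) :=
                Real.rpow_le_rpow_of_exponent_le (by norm_num) (by linarith)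
            _ = 2 := by norm_num
        _ = 2 * C₁ * τ := by ring
        _ ≤ T := by rw [hTdef]; gcongr
    exact ⟨(hup w w1 w2 w3).1.trans hb, (hup w w1 w2 w3).2.trans hb⟩
  have hC₁pos : 0 < 1 / C₁ := by positivity
  have hlow : 1 / (16 * T ^ 7) ≤ ‖riemannZeta s‖ := by
    refine norm_riemannZeta_ge_of_forall_le hT hs1 hs2 (by linarith)
      (fun w w1 w2 w3 w4 => hup' w (by linarith) w2 w3 w4) fun η e1 e2 => (hreal η e1 e2).trans ?_
    gcongr
    linarith
  set r := 1 / (32 * T ^ 8) with hr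
  have hrpos : 0 < r := by positivity
  have hr1 : r ≤ 1 / C₁ := by
    apply one_div_le_one_div_of_le (by linarith)
    linarith
  have hr2 : r ≤ 1 := by
    rw [hr, div_le_one (by positivity)]
    linarith
  have hball : ∀ z ∈ Metric.closedBall s r, ‖deriv riemannZeta z‖ ≤ T ∧ z ≠ 1 := by
    intro z hz
    rw [Metric.mem_closedBall, dist_eq_norm] at hz
    have hre := (Complex.abs_re_le_norm (z - s)).trans hz
    have him := (Complex.abs_im_le_norm (z - s)).trans hz
    rw [Complex.sub_re, abs_le] at hre
    rw [Complex.sub_im] at him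
    have hi1 := abs_sub_abs_le_abs_sub z.im s.im
    have hi2 := abs_sub_abs_le_abs_sub s.im z.im
    rw [abs_sub_comm] at hi2
    refine ⟨(hup' z (by linarith [hre.1]) (by linarith [hre.2]) (by linarith) (by linarith)).2, ?_⟩
    rintro rfl
    rw [Complex.one_im] at him hi2
    rw [abs_zero] at hi2
    linarith
  intro w hw
  refine ⟨?_, (hball w hw).1⟩
  have hmv : ‖riemannZeta s - riemannZeta w‖ ≤ T * ‖s - w‖ :=
    (convex_closedBall s r).norm_image_sub_le_of_norm_deriv_le
      (fun z hz => differentiableAt_riemannZeta (hball z hz).2) (fun z hz => (hball z hz).1)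
      hw (Metric.mem_closedBall_self hrpos.le)
  have h2 : T * ‖s - w‖ ≤ 1 / (32 * T ^ 7) := by
    calc T * ‖s - w‖ ≤ T * r := by
          gcongr
          rwa [Metric.mem_closedBall', dist_eq_norm] at hw
      _ = _ := by rw [hr]; field_simp
  have h3 : ‖riemannZeta s‖ ≤ ‖riemannZeta w‖ + ‖riemannZeta s - riemannZeta w‖ := by
    have := norm_add_le (riemannZeta w) (riemannZeta s - riemannZeta w)
    rwa [add_sub_cancel] at this
  have h4 : 1 / (16 * T ^ 7) = 1 / (32 * T ^ 7) + 1 / (32 * T ^ 7) := by field_simp; norm_num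
  linarith

/-- The Mellin transform of `t ↦ ∑ Λ(n) (1 - n t)⁺ - (t⁻¹ - 1)⁺ / 2`. -/
noncomputable def smoothErrorMellin (s : ℂ) : ℂ :=
  (-(deriv riemannZeta₁ s / riemannZeta₁ s) - 1 / 2) / (s * (s + 1))

lemma riemannZeta₁_eq_sub_one_mul {s : ℂ} (hs : s ≠ 1) :
    riemannZeta₁ s = (s - 1) * riemannZeta s := by
  rw [riemannZeta_eq_inv_sub_mul hs, ← mul_assoc, mul_inv_cancel₀ (sub_ne_zero.2 hs), one_mul]

lemma riemannZeta₁_ne_zero {s : ℂ} (hs : 1 ≤ s.re) : riemannZeta₁ s ≠ 0 := by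
  rcases eq_or_ne s 1 with rfl | h
  · simp
  · rw [riemannZeta₁_eq_sub_one_mul h]
    exact mul_ne_zero (sub_ne_zero.2 h) (riemannZeta_ne_zero_of_one_le_re hs)

lemma logDeriv_riemannZeta₁ {s : ℂ} (hs : s ≠ 1) (hz : riemannZeta s ≠ 0) :
    deriv riemannZeta₁ s / riemannZeta₁ s = 1 / (s - 1) + deriv riemannZeta s / riemannZeta s := by
  have he : riemannZeta₁ =ᶠ[nhds s] fun z => (z - 1) * riemannZeta z := by
    filter_upwards [isOpen_ne.mem_nhds hs] with z hz using riemannZeta₁_eq_sub_one_mul hz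
  have hd : HasDerivAt (fun z => (z - 1) * riemannZeta z)
      (1 * riemannZeta s + (s - 1) * deriv riemannZeta s) s :=
    ((hasDerivAt_id s).sub_const 1).mul (differentiableAt_riemannZeta hs).hasDerivAt
  rw [he.deriv_eq, hd.deriv, he.eq_of_nhds]
  have := sub_ne_zero.2 hs
  field_simp

lemma differentiableAt_smoothErrorMellin {s : ℂ} (h0 : s ≠ 0) (h1 : s + 1 ≠ 0)
    (hz : riemannZeta₁ s ≠ 0) : DifferentiableAt ℂ smoothErrorMellin s := by
  have h2 : DifferentiableAt ℂ (deriv riemannZeta₁) s :=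
    (differentiable_riemannZeta₁.contDiff (n := 2)).differentiable_deriv_two s
  have h3 : DifferentiableAt ℂ riemannZeta₁ s := differentiable_riemannZeta₁ s
  unfold smoothErrorMellin
  exact DifferentiableAt.div (((h2.div h3 hz).neg).sub_const _) (by fun_prop)
    (mul_ne_zero h0 h1)

lemma analyticAt_smoothErrorMellin {s : ℂ} (hs : 1 ≤ s.re) : AnalyticAt ℂ smoothErrorMellin s := by
  have h0 : s ≠ 0 := by rintro rfl; norm_num at hs
  have h1 : s + 1 ≠ 0 := by
    intro h
    have := congrArg Complex.re h
    simp at this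
    linarith
  have h2 : AnalyticAt ℂ riemannZeta₁ s := differentiable_riemannZeta₁.analyticAt s
  unfold smoothErrorMellin
  exact (((h2.deriv.div h2 (riemannZeta₁_ne_zero hs)).neg).sub analyticAt_const).div
    (analyticAt_id.mul (analyticAt_id.add analyticAt_const)) (mul_ne_zero h0 h1)

lemma analyticAt_iteratedDeriv_smoothErrorMellin (k : ℕ) {s : ℂ} (hs : 1 ≤ s.re) :
    AnalyticAt ℂ (iteratedDeriv k smoothErrorMellin) s := by
  rw [iteratedDeriv_eq_iterate]
  exact (analyticAt_smoothErrorMellin hs).iterated_deriv k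

lemma exists_norm_iteratedDeriv_smoothErrorMellin_le_of_two_le (k : ℕ) :
    ∃ C : ℝ, 0 ≤ C ∧ ∀ s : ℂ, 1 ≤ s.re → s.re ≤ 2 → 2 ≤ |s.im| →
      ‖iteratedDeriv k smoothErrorMellin s‖ ≤ C * (1 + |s.im|) ^ (-(3 / 2) : ℝ) := by
  set ε : ℝ := 1 / (16 * (k + 1)) with hε
  have hε0 : 0 < ε := by positivity
  have hε1 : ε ≤ 1 / 2 := by
    rw [hε]
    apply one_div_le_one_div_of_le (by norm_num)
    linarith [show (0 : ℝ) ≤ k from Nat.cast_nonneg k]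
  obtain ⟨C, hC, h⟩ := exists_riemannZeta_bounds_on_closedBall hε0 hε1
  refine ⟨k.factorial * 306 * 32 ^ k * C ^ (8 * (k + 1)), by positivity, fun s hs1 hs2 ht => ?_⟩
  set τ := 1 + |s.im| with hτ
  have hτ3 : 3 ≤ τ := by linarith
  set T := C * τ ^ ε with hT
  have hT1 : 1 ≤ T := one_le_mul_of_one_le_of_one_le hC (Real.one_le_rpow (by linarith) hε0.le)
  have hT8 : 1 ≤ T ^ 8 := one_le_pow₀ hT1
  have hT0 : 0 < T := by linarith
  have hball := h s hs1 hs2 ht T hT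
  set r := 1 / (32 * T ^ 8) with hr
  have hrpos : 0 < r := by positivity
  have hr2 : r ≤ 1 := by
    rw [hr, div_le_one (by positivity)]
    linarith
  have him : ∀ z ∈ Metric.closedBall s r, τ / 3 ≤ |z.im| ∧ 1 ≤ |z.im| := by
    intro z hz
    rw [Metric.mem_closedBall', dist_eq_norm] at hz
    have him := (Complex.abs_im_le_norm (s - z)).trans hz
    rw [Complex.sub_im] at him
    have hi2 := abs_sub_abs_le_abs_sub s.im z.im
    constructor <;> linarith
  have hne : ∀ z ∈ Metric.closedBall s r, z ≠ 1 ∧ z ≠ 0 ∧ z + 1 ≠ 0 ∧ riemannZeta z ≠ 0 := by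
    intro z hz
    have h1 := (him z hz).2
    refine ⟨?_, ?_, ?_, ?_⟩
    · rintro rfl; norm_num at h1
    · rintro rfl; norm_num at h1
    · intro h0
      have := congrArg Complex.im h0
      simp at this
      norm_num [this] at h1
    · rw [← norm_pos_iff]
      exact lt_of_lt_of_le (by positivity) (hball z hz).1
  have hd : DiffContOnCl ℂ smoothErrorMellin (Metric.ball s r) := by
    refine DifferentiableOn.diffContOnCl fun z hz => ?_
    obtain ⟨n1, n2, n3, n4⟩ := hne z (Metric.closure_ball_subset_closedBall hz)
    refine (differentiableAt_smoothErrorMellin n2 n3 ?_).differentiableWithinAt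
    rw [riemannZeta₁_eq_sub_one_mul n1]
    exact mul_ne_zero (sub_ne_zero.2 n1) n4
  have hbound : ∀ z ∈ Metric.sphere s r, ‖smoothErrorMellin z‖ ≤ 306 * T ^ 8 / τ ^ 2 := by
    intro z hz
    have hz := Metric.sphere_subset_closedBall hz
    obtain ⟨n1, n2, n3, n4⟩ := hne z hz
    obtain ⟨i1, i2⟩ := him z hz
    obtain ⟨b1, b2⟩ := hball z hz
    rw [smoothErrorMellin, logDeriv_riemannZeta₁ n1 n4, norm_div, norm_mul]
    have hz0 : τ / 3 ≤ ‖z‖ := i1.trans (Complex.abs_im_le_norm z)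
    have hz1 : τ / 3 ≤ ‖z + 1‖ := i1.trans (by simpa using Complex.abs_im_le_norm (z + 1))
    have hz2 : 1 ≤ ‖z - 1‖ := i2.trans (by simpa using Complex.abs_im_le_norm (z - 1))
    have hq : ‖deriv riemannZeta z / riemannZeta z‖ ≤ 32 * T ^ 8 := by
      rw [norm_div]
      calc ‖deriv riemannZeta z‖ / ‖riemannZeta z‖ ≤ T / (1 / (32 * T ^ 7)) := by gcongr
        _ = 32 * T ^ 8 := by field_simp
    have hp : ‖1 / (z - 1)‖ ≤ 1 := by
      rw [norm_div, norm_one]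
      exact (div_le_one (by linarith)).2 hz2
    have hnum : ‖-(1 / (z - 1) + deriv riemannZeta z / riemannZeta z) - 1 / 2‖ ≤ 34 * T ^ 8 := by
      have e1 := norm_sub_le (-(1 / (z - 1) + deriv riemannZeta z / riemannZeta z)) (1 / 2 : ℂ)
      rw [norm_neg] at e1
      have e2 := norm_add_le (1 / (z - 1)) (deriv riemannZeta z / riemannZeta z)
      have e3 : ‖(1 / 2 : ℂ)‖ = 1 / 2 := by norm_num
      linarith
    calc _ ≤ 34 * T ^ 8 / (τ / 3 * (τ / 3)) := by gcongr
      _ = _ := by field_simp; norm_num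
  refine (Complex.norm_iteratedDeriv_le_of_forall_mem_sphere_norm_le k hrpos hd hbound).trans ?_
  have e1 : (k.factorial : ℝ) * (306 * T ^ 8 / τ ^ 2) / r ^ k
      = k.factorial * 306 * 32 ^ k * (T ^ (8 * (k + 1)) / τ ^ 2) := by
    rw [hr, one_div, inv_pow, div_inv_eq_mul]
    ring
  have hτ0 : 0 < τ := by linarith
  have e2 : T ^ (8 * (k + 1)) / τ ^ 2 = C ^ (8 * (k + 1)) * τ ^ (-(3 / 2) : ℝ) := by
    rw [hT, mul_pow, ← Real.rpow_natCast (τ ^ ε), ← Real.rpow_mul hτ0.le,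
      show ε * ((8 * (k + 1) : ℕ) : ℝ) = 1 / 2 by rw [hε]; push_cast; field_simp; norm_num,
      mul_div_assoc, ← Real.rpow_natCast τ 2, ← Real.rpow_sub hτ0]
    norm_num
  rw [e1, e2]
  exact le_of_eq (by ring)

lemma exists_norm_iteratedDeriv_smoothErrorMellin_le (k : ℕ) :
    ∃ C : ℝ, 0 ≤ C ∧ ∀ s : ℂ, 1 ≤ s.re → s.re ≤ 2 →
      ‖iteratedDeriv k smoothErrorMellin s‖ ≤ C * (1 + |s.im|) ^ (-(3 / 2) : ℝ) := by
  obtain ⟨C₁, hC₁, h₁⟩ := exists_norm_iteratedDeriv_smoothErrorMellin_le_of_two_le k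
  have hcomp : IsCompact (Set.Icc (1 : ℝ) 2 ×ℂ Set.Icc (-2 : ℝ) 2) :=
    isCompact_Icc.reProdIm isCompact_Icc
  obtain ⟨C₂, h₂⟩ := hcomp.exists_bound_of_continuousOn
    (f := iteratedDeriv k smoothErrorMellin) fun s hs =>
      (analyticAt_iteratedDeriv_smoothErrorMellin k hs.1.1).continuousAt.continuousWithinAt
  have h20 : 0 ≤ C₂ := (norm_nonneg _).trans (h₂ 1 (by simp [Complex.mem_reProdIm]))
  refine ⟨C₁ + C₂ * 3 ^ (3 / 2 : ℝ), by positivity, fun s hs1 hs2 => ?_⟩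
  rcases le_total 2 |s.im| with h | h
  · refine (h₁ s hs1 hs2 h).trans ?_
    gcongr
    have : 0 ≤ C₂ * (3 : ℝ) ^ (3 / 2 : ℝ) := by positivity
    linarith
  · refine (h₂ s (Complex.mem_reProdIm.2 ⟨⟨hs1, hs2⟩, abs_le.1 h⟩)).trans ?_
    have h3 : (3 : ℝ) ^ (-(3 / 2) : ℝ) ≤ (1 + |s.im|) ^ (-(3 / 2) : ℝ) :=
      Real.rpow_le_rpow_of_nonpos (by positivity) (by linarith) (by norm_num)
    have h4 : (3 : ℝ) ^ (3 / 2 : ℝ) * 3 ^ (-(3 / 2) : ℝ) = 1 := by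
      rw [← Real.rpow_add (by norm_num)]; norm_num
    calc C₂ = C₂ * 3 ^ (3 / 2 : ℝ) * 3 ^ (-(3 / 2) : ℝ) := by rw [mul_assoc, h4, mul_one]
      _ ≤ (C₁ + C₂ * 3 ^ (3 / 2 : ℝ)) * 3 ^ (-(3 / 2) : ℝ) := by gcongr; linarith
      _ ≤ _ := by gcongr

lemma mellin_tsum_mul_comp_mul {a : ℕ → ℂ} {φ : ℝ → ℂ} {s : ℂ} (h0 : a 0 = 0)
    (ha : LSeriesSummable a s) (hφ : MellinConvergent φ s) :
    mellin (fun t => ∑' n : ℕ, a n * φ (n * t)) s = mellin φ s * LSeries a s := by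
  have hconv : ∀ n : ℕ, MellinConvergent (fun t => a n * φ (n * t)) s := by
    intro n
    rcases Nat.eq_zero_or_pos n with rfl | hn
    · simp [h0, MellinConvergent]
    · exact ((MellinConvergent.comp_mul_left (Nat.cast_pos.2 hn)).2 hφ).const_smul (a n)
  have hterm : ∀ n : ℕ, ∫ t in Set.Ioi (0 : ℝ), (t : ℂ) ^ (s - 1) • (a n * φ (n * t))
      = mellin φ s * LSeries.term a s n := by
    intro n
    rcases Nat.eq_zero_or_pos n with rfl | hn
    · simp [h0]
    · have h1 := mellin_const_smul (fun t : ℝ => φ (n * t)) s (a n)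
      rw [mellin_comp_mul_left φ s (Nat.cast_pos.2 hn)] at h1
      rw [LSeries.term_of_ne_zero hn.ne']
      refine (show _ = _ from h1).trans ?_
      simp only [smul_eq_mul, Complex.ofReal_natCast, Complex.cpow_neg]
      ring
  have hnorm : ∀ n : ℕ, ∫ t in Set.Ioi (0 : ℝ), ‖(t : ℂ) ^ (s - 1) • (a n * φ (n * t))‖
      = ‖LSeries.term a s n‖ * ∫ t in Set.Ioi (0 : ℝ), ‖(t : ℂ) ^ (s - 1) • φ t‖ := by
    intro n
    rcases Nat.eq_zero_or_pos n with rfl | hn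
    · simp [h0]
    · have hn' : (0 : ℝ) < n := Nat.cast_pos.2 hn
      have h1 := MeasureTheory.integral_comp_mul_left_Ioi
        (fun t : ℝ => ‖(t : ℂ) ^ (s - 1) • φ t‖) 0 hn'
      rw [mul_zero] at h1
      have h2 : ∀ t ∈ Set.Ioi (0 : ℝ), ‖(t : ℂ) ^ (s - 1) • (a n * φ (n * t))‖
          = (‖a n‖ / (n : ℝ) ^ (s.re - 1)) *
            ‖(((n : ℝ) * t : ℝ) : ℂ) ^ (s - 1) • φ (n * t)‖ := by
        intro t ht
        have ht' : (0 : ℝ) < t := ht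
        rw [norm_smul, norm_smul, norm_mul, Complex.norm_cpow_eq_rpow_re_of_pos ht',
          Complex.norm_cpow_eq_rpow_re_of_pos (mul_pos hn' ht'), Complex.sub_re, Complex.one_re,
          Real.mul_rpow hn'.le ht'.le]
        have : (n : ℝ) ^ (s.re - 1) ≠ 0 := (Real.rpow_pos_of_pos hn' _).ne'
        field_simp
      rw [MeasureTheory.setIntegral_congr_fun measurableSet_Ioi h2,
        MeasureTheory.integral_const_mul, h1, LSeries.norm_term_eq, if_neg hn.ne',
        Real.rpow_sub hn', Real.rpow_one, smul_eq_mul]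
      have : (n : ℝ) ^ s.re ≠ 0 := (Real.rpow_pos_of_pos hn' _).ne'
      field_simp
  have hsum := MeasureTheory.hasSum_integral_of_summable_integral_norm
    (F := fun (n : ℕ) (t : ℝ) => (t : ℂ) ^ (s - 1) • (a n * φ (n * t))) hconv
    (by simp_rw [hnorm]; exact ha.norm.mul_right _)
  simp_rw [hterm] at hsum
  rw [mellin, LSeries, ← tsum_mul_left, hsum.tsum_eq]
  simp only [smul_eq_mul, tsum_mul_left]

lemma hasMellin_max_one_sub_zero {s : ℂ} (hs : 0 < s.re) :
    HasMellin (fun t : ℝ => ((max (1 - t) 0 : ℝ) : ℂ)) s (1 / (s * (s + 1))) := by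
  have h1 := hasMellin_one_Ioc hs
  have h2 := hasMellin_cpow_Ioc 1 (s := s) (by simp; linarith)
  have h3 := hasMellin_sub h1.1 h2.1
  rw [h1.2, h2.2] at h3
  have he : Set.EqOn (fun t : ℝ => (t : ℂ) ^ (s - 1) •
      (((Set.Ioc 0 1).indicator (fun _ => (1 : ℂ)) t) -
        ((Set.Ioc 0 1).indicator (fun t : ℝ => (t : ℂ) ^ (1 : ℂ)) t)))
      (fun t : ℝ => (t : ℂ) ^ (s - 1) • ((max (1 - t) 0 : ℝ) : ℂ)) (Set.Ioi 0) := by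
    intro t ht
    have ht : 0 < t := ht
    simp only
    congr 1
    by_cases h : t ≤ 1
    · have hm : t ∈ Set.Ioc (0 : ℝ) 1 := ⟨ht, h⟩
      rw [Set.indicator_of_mem hm, Set.indicator_of_mem hm,
        max_eq_left (by linarith), Complex.cpow_one]
      push_cast
      rfl
    · have hm : t ∉ Set.Ioc (0 : ℝ) 1 := fun h' => h h'.2
      rw [Set.indicator_of_notMem hm, Set.indicator_of_notMem hm,
        max_eq_right (by linarith)]
      simp
  have hs0 : s ≠ 0 := by rintro rfl; simp at hs
  have hs1 : s + 1 ≠ 0 := by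
    intro h
    have := congrArg Complex.re h
    simp at this
    linarith
  refine ⟨h3.1.congr_fun he measurableSet_Ioi, ?_⟩
  rw [mellin, ← MeasureTheory.setIntegral_congr_fun measurableSet_Ioi he]
  refine (show _ = _ from h3.2).trans ?_
  field_simp
  ring

lemma hasMellin_max_inv_sub_one_zero {s : ℂ} (hs : 1 < s.re) :
    HasMellin (fun t : ℝ => ((max (t⁻¹ - 1) 0 / 2 : ℝ) : ℂ)) s (1 / 2 / (s * (s - 1))) := by
  have h1 := hasMellin_cpow_Ioc (-1) (s := s) (by simp; linarith)
  have h2 := hasMellin_one_Ioc (s := s) (by linarith)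
  have h3 := hasMellin_sub h1.1 h2.1
  rw [h1.2, h2.2] at h3
  have h4 := hasMellin_const_smul h3.1 (1 / 2 : ℂ)
  rw [h3.2] at h4
  have he : Set.EqOn (fun t : ℝ => (t : ℂ) ^ (s - 1) • ((1 / 2 : ℂ) •
      (((Set.Ioc 0 1).indicator (fun t : ℝ => (t : ℂ) ^ (-1 : ℂ)) t) -
      ((Set.Ioc 0 1).indicator (fun _ => (1 : ℂ)) t))))
      (fun t : ℝ => (t : ℂ) ^ (s - 1) • ((max (t⁻¹ - 1) 0 / 2 : ℝ) : ℂ)) (Set.Ioi 0) := by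
    intro t ht
    have ht : 0 < t := ht
    simp only
    congr 1
    by_cases h : t ≤ 1
    · have hm : t ∈ Set.Ioc (0 : ℝ) 1 := ⟨ht, h⟩
      rw [Set.indicator_of_mem hm, Set.indicator_of_mem hm,
        max_eq_left (by linarith [(one_le_inv₀ ht).2 h]), Complex.cpow_neg_one]
      push_cast
      rw [smul_eq_mul]
      ring
    · have hm : t ∉ Set.Ioc (0 : ℝ) 1 := fun h' => h h'.2
      rw [Set.indicator_of_notMem hm, Set.indicator_of_notMem hm,
        max_eq_right (by linarith [(inv_le_one₀ ht).2 (not_le.1 h).le])]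
      simp
  have hs0 : s ≠ 0 := by rintro rfl; norm_num at hs
  have hs1 : s - 1 ≠ 0 := by
    intro h
    have := congrArg Complex.re h
    simp at this
    linarith
  refine ⟨h4.1.congr_fun he measurableSet_Ioi, ?_⟩
  rw [mellin, ← MeasureTheory.setIntegral_congr_fun measurableSet_Ioi he]
  refine (show _ = _ from h4.2).trans ?_
  rw [smul_eq_mul, show s + -1 = s - 1 by ring]
  field_simp
  ring

lemma isBigO_log_pow_smul {f : ℝ → ℂ} {C : ℝ}
    (hC : ∀ t, 0 < t → ‖f t‖ ≤ C * t⁻¹) (k : ℕ) {b : ℝ} (hb : 1 < b) :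
    (fun t => (Real.log t) ^ k • f t) =O[nhdsWithin 0 (Set.Ioi 0)] fun t : ℝ => t ^ (-b) := by
  induction k generalizing b with
  | zero =>
    simp only [pow_zero, one_smul]
    have h1 : f =O[nhdsWithin 0 (Set.Ioi 0)] fun t : ℝ => t ^ (-1 : ℝ) := by
      refine Asymptotics.IsBigO.of_bound C ?_
      filter_upwards [self_mem_nhdsWithin] with t ht
      have ht : 0 < t := ht
      rw [Real.rpow_neg_one, Real.norm_of_nonneg (by positivity)]
      exact hC t ht
    refine h1.trans (Asymptotics.IsBigO.of_bound 1 ?_)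
    filter_upwards [Ioo_mem_nhdsGT zero_lt_one] with t ht
    have h0 := ht.1
    rw [one_mul, Real.norm_of_nonneg (by positivity), Real.norm_of_nonneg (by positivity)]
    exact Real.rpow_le_rpow_of_exponent_ge h0 ht.2.le (by linarith)
  | succ k ih =>
    have h := isBigO_rpow_zero_log_smul (show (1 + b) / 2 < b by linarith)
      (ih (show 1 < (1 + b) / 2 by linarith))
    simpa only [smul_smul, ← pow_succ'] using h

lemma iteratedDeriv_mellin {f : ℝ → ℂ} {C : ℝ} (hf : ContinuousOn f (Set.Ioi 0))
    (hz : ∀ t, 1 ≤ t → f t = 0) (hC : ∀ t, 0 < t → ‖f t‖ ≤ C * t⁻¹) (k : ℕ) {s : ℂ}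
    (hs : 1 < s.re) :
    MellinConvergent (fun t => (Real.log t) ^ k • f t) s ∧
      iteratedDeriv k (mellin f) s = mellin (fun t => (Real.log t) ^ k • f t) s := by
  have hloc : ∀ k : ℕ, MeasureTheory.LocallyIntegrableOn (fun t => (Real.log t) ^ k • f t)
      (Set.Ioi 0) := fun k => by
    have hlog : ContinuousOn Real.log (Set.Ioi 0) :=
      Real.continuousOn_log.mono fun t ht => (show 0 < t from ht).ne'
    have h : ContinuousOn (fun t => (Real.log t) ^ k • f t) (Set.Ioi 0) := (hlog.pow k).smul hf
    exact h.locallyIntegrableOn measurableSet_Ioi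
  have htop : ∀ (k : ℕ) (a : ℝ),
      (fun t => (Real.log t) ^ k • f t) =O[atTop] fun t : ℝ => t ^ (-a) := fun k a => by
    refine Asymptotics.IsBigO.of_bound 0 ?_
    filter_upwards [eventually_ge_atTop 1] with t ht
    simp [hz t ht]
  have hd : ∀ (k : ℕ) (s : ℂ), 1 < s.re →
      MellinConvergent (fun t => (Real.log t) ^ k • f t) s ∧
      HasDerivAt (mellin (fun t => (Real.log t) ^ k • f t))
        (mellin (fun t => (Real.log t) ^ (k + 1) • f t) s) s := by
    intro k s hs
    refine ⟨mellinConvergent_of_isBigO_rpow (hloc k) (htop k (s.re + 1)) (by linarith)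
      (isBigO_log_pow_smul hC k (show 1 < (1 + s.re) / 2 by linarith)) (by linarith), ?_⟩
    have := (mellin_hasDerivAt_of_isBigO_rpow (hloc k) (htop k (s.re + 1)) (by linarith)
      (isBigO_log_pow_smul hC k (show 1 < (1 + s.re) / 2 by linarith)) (by linarith)).2
    simpa only [smul_smul, ← pow_succ'] using this
  refine ⟨(hd k s hs).1, ?_⟩
  induction k generalizing s with
  | zero => simp
  | succ k ih =>
    rw [iteratedDeriv_succ, EventuallyEq.deriv_eq (f := mellin (fun t => (Real.log t) ^ k • f t))]
    · exact (hd k s hs).2.deriv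
    · filter_upwards [(isOpen_lt continuous_const Complex.continuous_re).mem_nhds hs] with z hz
      exact ih hz

/-- The Riesz mean `∑ Λ(n) (1 - n t)⁺` of the von Mangoldt function. -/
noncomputable def rieszVonMangoldt (t : ℝ) : ℝ :=
  ∑' n : ℕ, ArithmeticFunction.vonMangoldt n * max (1 - n * t) 0

lemma rieszVonMangoldt_eq_sum {t : ℝ} (ht : 0 < t) {N : ℕ} (hN : t⁻¹ ≤ N) :
    rieszVonMangoldt t
      = ∑ n ∈ Finset.Ioc 0 N, ArithmeticFunction.vonMangoldt n * max (1 - n * t) 0 := by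
  refine tsum_eq_sum fun n hn => ?_
  rcases Nat.eq_zero_or_pos n with rfl | h0
  · simp
  · have h1 : (N : ℝ) ≤ n := by
      simp only [Finset.mem_Ioc, not_and, not_le] at hn
      exact_mod_cast (hn h0).le
    have h2 : 1 ≤ n * t := (inv_le_iff_one_le_mul₀ ht).1 (hN.trans h1)
    rw [max_eq_right (by linarith), mul_zero]

lemma continuousAt_rieszVonMangoldt {t : ℝ} (ht : 0 < t) : ContinuousAt rieszVonMangoldt t := by
  have he : rieszVonMangoldt =ᶠ[nhds t] fun u =>
      ∑ n ∈ Finset.Ioc 0 ⌈(t / 2)⁻¹⌉₊, ArithmeticFunction.vonMangoldt n * max (1 - n * u) 0 := by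
    filter_upwards [Ioi_mem_nhds (half_lt_self ht)] with u hu
    have hu : t / 2 < u := hu
    exact rieszVonMangoldt_eq_sum (by linarith)
      ((inv_anti₀ (by linarith) hu.le).trans (Nat.le_ceil _))
  refine ContinuousAt.congr (Continuous.continuousAt ?_) he.symm
  fun_prop

lemma rieszVonMangoldt_nonneg (t : ℝ) : 0 ≤ rieszVonMangoldt t :=
  tsum_nonneg fun _ => mul_nonneg ArithmeticFunction.vonMangoldt_nonneg (le_max_right _ _)

lemma rieszVonMangoldt_le {t : ℝ} (ht : 0 < t) :
    rieszVonMangoldt t ≤ (Real.log 4 + 4) * t⁻¹ + (Real.log 4 + 4) := by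
  have h0 : 0 ≤ t⁻¹ := by positivity
  rw [rieszVonMangoldt_eq_sum ht (Nat.le_ceil _)]
  calc _ ≤ ∑ n ∈ Finset.Ioc 0 ⌈t⁻¹⌉₊, ArithmeticFunction.vonMangoldt n := by
        refine Finset.sum_le_sum fun n _ => mul_le_of_le_one_right
          ArithmeticFunction.vonMangoldt_nonneg (max_le ?_ zero_le_one)
        have : 0 ≤ n * t := by positivity
        linarith
    _ = Chebyshev.psi ⌈t⁻¹⌉₊ := by rw [Chebyshev.psi, Nat.floor_natCast]
    _ ≤ (Real.log 4 + 4) * ⌈t⁻¹⌉₊ := Chebyshev.psi_le_const_mul_self (by positivity)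
    _ ≤ (Real.log 4 + 4) * (t⁻¹ + 1) := by
        have h4 : 0 ≤ Real.log 4 := Real.log_nonneg (by norm_num)
        gcongr
        exact (Nat.ceil_lt_add_one h0).le
    _ = _ := by ring

lemma rieszVonMangoldt_eq_zero {t : ℝ} (ht : 1 ≤ t) : rieszVonMangoldt t = 0 := by
  have h : t⁻¹ ≤ (1 : ℕ) := by simpa using inv_le_one_of_one_le₀ ht
  rw [rieszVonMangoldt_eq_sum (by linarith) h]
  simp

/-- The difference between the Riesz mean of the von Mangoldt function and its main term. -/
noncomputable def rieszError (t : ℝ) : ℝ := rieszVonMangoldt t - max (t⁻¹ - 1) 0 / 2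

lemma continuousAt_rieszError {t : ℝ} (ht : 0 < t) : ContinuousAt rieszError t := by
  have h := continuousAt_inv₀ ht.ne'
  exact (continuousAt_rieszVonMangoldt ht).sub
    (((h.sub continuousAt_const).max continuousAt_const).div_const 2)

lemma rieszError_eq_zero {t : ℝ} (ht : 1 ≤ t) : rieszError t = 0 := by
  rw [rieszError, rieszVonMangoldt_eq_zero ht,
    max_eq_right (by linarith [inv_le_one_of_one_le₀ ht])]
  simp

lemma abs_rieszError_le {t : ℝ} (ht : 0 < t) :
    |rieszError t| ≤ (2 * (Real.log 4 + 4) + 1) * t⁻¹ := by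
  have h4 : 0 ≤ Real.log 4 := Real.log_nonneg (by norm_num)
  have h0 : 0 ≤ t⁻¹ := by positivity
  rcases le_or_gt 1 t with h | h
  · rw [rieszError_eq_zero h, abs_zero]
    positivity
  · have h1 : 1 ≤ t⁻¹ := (one_le_inv₀ ht).2 h.le
    have h2 := rieszVonMangoldt_nonneg t
    have h3 := rieszVonMangoldt_le ht
    have h5 : (Real.log 4 + 4) * 1 ≤ (Real.log 4 + 4) * t⁻¹ := by gcongr
    rw [rieszError, max_eq_left (by linarith), abs_le]
    constructor <;> nlinarith

lemma mellin_rieszError {s : ℂ} (hs : 1 < s.re) :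
    mellin (fun t => (rieszError t : ℂ)) s = smoothErrorMellin s := by
  have h1 := hasMellin_max_one_sub_zero (s := s) (by linarith)
  have h2 := hasMellin_max_inv_sub_one_zero hs
  have h3 := mellin_tsum_mul_comp_mul (a := fun n => (ArithmeticFunction.vonMangoldt n : ℂ))
    (by simp) (ArithmeticFunction.LSeriesSummable_vonMangoldt hs) h1.1
  have he : ∀ t : ℝ, ∑' n : ℕ, (ArithmeticFunction.vonMangoldt n : ℂ) *
      ((max (1 - n * t) 0 : ℝ) : ℂ) = (rieszVonMangoldt t : ℂ) := by
    intro t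
    rw [rieszVonMangoldt, Complex.ofReal_tsum]
    simp only [Complex.ofReal_mul]
  simp_rw [he] at h3
  rw [h1.2, ArithmeticFunction.LSeries_vonMangoldt_eq_deriv_riemannZeta_div hs] at h3
  have hloc : MeasureTheory.LocallyIntegrableOn (fun t => (rieszVonMangoldt t : ℂ))
      (Set.Ioi 0) := by
    refine ContinuousOn.locallyIntegrableOn (fun t ht => ?_) measurableSet_Ioi
    exact (Complex.continuous_ofReal.continuousAt.comp
      (continuousAt_rieszVonMangoldt ht)).continuousWithinAt
  have hconv : MellinConvergent (fun t => (rieszVonMangoldt t : ℂ)) s := by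
    refine mellinConvergent_of_isBigO_rpow (a := s.re + 1) (b := 1) hloc ?_ (by linarith) ?_ hs
    · refine Asymptotics.IsBigO.of_bound 0 ?_
      filter_upwards [eventually_ge_atTop 1] with t ht
      simp [rieszVonMangoldt_eq_zero ht]
    · refine Asymptotics.IsBigO.of_bound (2 * (Real.log 4 + 4)) ?_
      filter_upwards [Ioo_mem_nhdsGT zero_lt_one] with t ht
      have h0 := ht.1
      have h1 : 1 ≤ t⁻¹ := (one_le_inv₀ ht.1).2 ht.2.le
      have h4 : 0 ≤ Real.log 4 := Real.log_nonneg (by norm_num)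
      have h5 : (Real.log 4 + 4) * 1 ≤ (Real.log 4 + 4) * t⁻¹ := by gcongr
      rw [Complex.norm_real, Real.norm_of_nonneg (rieszVonMangoldt_nonneg t), Real.rpow_neg_one,
        Real.norm_of_nonneg (by positivity)]
      linarith [rieszVonMangoldt_le ht.1]
  have h4 := (hasMellin_sub hconv h2.1).2
  rw [h3, h2.2] at h4
  have hs0 : s ≠ 0 := by rintro rfl; norm_num at hs
  have hs1 : s ≠ 1 := by rintro rfl; norm_num at hs
  have hs2 : s + 1 ≠ 0 := by
    intro h
    have := congrArg Complex.re h
    simp at this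
    linarith
  have hz := riemannZeta_ne_zero_of_one_le_re hs.le
  have hs3 := sub_ne_zero.2 hs1
  have h5 : (fun t => (rieszError t : ℂ)) =
      fun t : ℝ => (rieszVonMangoldt t : ℂ) - ((max (t⁻¹ - 1) 0 / 2 : ℝ) : ℂ) := by
    funext t
    rw [rieszError, Complex.ofReal_sub]
  rw [h5, h4, smoothErrorMellin, logDeriv_riemannZeta₁ hs1 hz]
  field_simp
  ring

lemma exists_abs_log_pow_mul_abs_rieszError_le (k : ℕ) :
    ∃ C : ℝ, ∀ t, 0 < t → |Real.log t| ^ k * |rieszError t| ≤ C * t⁻¹ := by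
  obtain ⟨C, hC, hb⟩ := exists_norm_iteratedDeriv_smoothErrorMellin_le k
  set f : ℝ → ℂ := fun t => (rieszError t : ℂ) with hf
  have hcf : ∀ t, 0 < t → ContinuousAt f t := fun t ht =>
    Complex.continuous_ofReal.continuousAt.comp (continuousAt_rieszError ht)
  have hcont : ContinuousOn f (Set.Ioi 0) := fun t ht => (hcf t ht).continuousWithinAt
  have hzero : ∀ t, 1 ≤ t → f t = 0 := fun t ht => by simp [hf, rieszError_eq_zero ht]
  have hbd : ∀ t, 0 < t → ‖f t‖ ≤ (2 * (Real.log 4 + 4) + 1) * t⁻¹ := fun t ht => by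
    rw [hf, Complex.norm_real]
    exact abs_rieszError_le ht
  set g : ℝ → ℂ := fun t => (Real.log t) ^ k • f t with hg
  have hmel : ∀ s : ℂ, 1 < s.re → mellin g s = iteratedDeriv k smoothErrorMellin s := by
    intro s hs
    rw [hg, ← (iteratedDeriv_mellin hcont hzero hbd k hs).2]
    refine EventuallyEq.iteratedDeriv_eq k ?_
    filter_upwards [(isOpen_lt continuous_const Complex.continuous_re).mem_nhds hs] with z hz
    exact mellin_rieszError hz
  have hdom : MeasureTheory.Integrable (fun y : ℝ => C * (1 + |y|) ^ (-(3 / 2) : ℝ)) :=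
    (integrable_one_add_norm (E := ℝ) (r := 3 / 2) (by norm_num)).const_mul C
  set K : ℝ := ∫ y : ℝ, C * (1 + |y|) ^ (-(3 / 2) : ℝ) with hK
  have main : ∀ σ : ℝ, 1 < σ → σ ≤ 2 → ∀ t, 0 < t →
      |Real.log t| ^ k * |rieszError t| ≤ 1 / (2 * Real.pi) * (K * t ^ (-σ)) := by
    intro σ h1 h2 t ht
    have hnb : ∀ y : ℝ, ‖mellin g (σ + y * Complex.I)‖ ≤ C * (1 + |y|) ^ (-(3 / 2) : ℝ) := by
      intro y
      rw [hmel _ (by simpa using h1)]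
      simpa using hb (σ + y * Complex.I) (by simpa using h1.le) (by simpa using h2)
    have hvc : Continuous fun y : ℝ => mellin g (σ + y * Complex.I) := by
      have : (fun y : ℝ => mellin g (σ + y * Complex.I))
          = fun y : ℝ => iteratedDeriv k smoothErrorMellin (σ + y * Complex.I) :=
        funext fun y => hmel _ (by simpa using h1)
      rw [this, continuous_iff_continuousAt]
      intro y
      exact ContinuousAt.comp (f := fun y : ℝ => (σ + y * Complex.I : ℂ))
        (analyticAt_iteratedDeriv_smoothErrorMellin k (by simpa using h1.le)).continuousAt
        (by fun_prop)
    have hv : Complex.VerticalIntegrable (mellin g) σ :=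
      hdom.mono' hvc.aestronglyMeasurable (Eventually.of_forall hnb)
    have hga : ContinuousAt g t := ((Real.continuousAt_log ht.ne').pow k).smul (hcf t ht)
    have hinv := mellinInv_mellin_eq σ g ht
      (iteratedDeriv_mellin hcont hzero hbd k (s := σ) (by simpa using h1)).1 hv hga
    have hgn : ‖g t‖ = |Real.log t| ^ k * |rieszError t| := by
      simp [hg, hf]
    rw [← hgn, ← hinv, mellinInv, norm_smul, Real.norm_of_nonneg (by positivity)]
    gcongr
    rw [hK, ← MeasureTheory.integral_mul_const]
    refine MeasureTheory.norm_integral_le_of_norm_le (hdom.mul_const _)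
      (Eventually.of_forall fun y => ?_)
    rw [norm_smul, Complex.norm_cpow_eq_rpow_re_of_pos ht, mul_comm]
    have : (-(σ + y * Complex.I) : ℂ).re = -σ := by simp
    rw [this]
    gcongr
    exact hnb y
  refine ⟨1 / (2 * Real.pi) * K, fun t ht => ?_⟩
  have htend : Tendsto (fun σ : ℝ => 1 / (2 * Real.pi) * (K * t ^ (-σ))) (nhdsWithin 1 (Set.Ioi 1))
      (nhds (1 / (2 * Real.pi) * (K * t ^ (-1 : ℝ)))) := by
    refine tendsto_nhdsWithin_of_tendsto_nhds (Continuous.tendsto ?_ 1)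
    have := Real.continuous_const_rpow ht.ne'
    fun_prop
  rw [Real.rpow_neg_one, ← mul_assoc] at htend
  refine ge_of_tendsto htend ?_
  filter_upwards [Ioo_mem_nhdsGT (show (1 : ℝ) < 2 by norm_num)] with σ hσ
  exact main σ hσ.1 hσ.2.le t ht

lemma mul_rieszVonMangoldt_inv_eq_sum {x : ℝ} (hx : 0 < x) {N : ℕ} (hN : x ≤ N) :
    x * rieszVonMangoldt x⁻¹
      = ∑ n ∈ Finset.Ioc 0 N, ArithmeticFunction.vonMangoldt n * max (x - n) 0 := by
  rw [rieszVonMangoldt_eq_sum (inv_pos.2 hx) (by rwa [inv_inv]), Finset.mul_sum]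
  refine Finset.sum_congr rfl fun n _ => ?_
  rw [mul_left_comm, mul_max_of_nonneg _ _ hx.le, mul_zero, mul_sub, mul_one, mul_left_comm,
    mul_inv_cancel₀ hx.ne', mul_one]

lemma psi_eq_sum_ite {x : ℝ} {N : ℕ} (hN : x ≤ N) :
    Chebyshev.psi x
      = ∑ n ∈ Finset.Ioc 0 N, if (n : ℝ) ≤ x then ArithmeticFunction.vonMangoldt n else 0 := by
  rw [Chebyshev.psi, ← Finset.sum_filter]
  refine Finset.sum_congr ?_ fun _ _ => rfl
  ext n
  simp only [Finset.mem_Ioc, Finset.mem_filter]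
  constructor
  · rintro ⟨h1, h2⟩
    have h3 := (Nat.le_floor_iff' h1.ne').1 h2
    exact ⟨⟨h1, by exact_mod_cast h3.trans hN⟩, h3⟩
  · rintro ⟨⟨h1, -⟩, h2⟩
    exact ⟨h1, Nat.le_floor h2⟩

lemma sub_mul_psi_le_and_le {x y : ℝ} (hx : 0 < x) (hxy : x ≤ y) :
    (y - x) * Chebyshev.psi x ≤ y * rieszVonMangoldt y⁻¹ - x * rieszVonMangoldt x⁻¹ ∧
      y * rieszVonMangoldt y⁻¹ - x * rieszVonMangoldt x⁻¹ ≤ (y - x) * Chebyshev.psi y := by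
  have hN := Nat.le_ceil y
  rw [mul_rieszVonMangoldt_inv_eq_sum hx (hxy.trans hN),
    mul_rieszVonMangoldt_inv_eq_sum (hx.trans_le hxy) hN, psi_eq_sum_ite (hxy.trans hN),
    psi_eq_sum_ite hN, ← Finset.sum_sub_distrib, Finset.mul_sum, Finset.mul_sum]
  constructor
  · refine Finset.sum_le_sum fun n _ => ?_
    have hn : 0 ≤ ArithmeticFunction.vonMangoldt n := ArithmeticFunction.vonMangoldt_nonneg
    split_ifs with h
    · rw [max_eq_left (by linarith), max_eq_left (by linarith)]
      exact le_of_eq (by ring)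
    · rw [mul_zero, ← mul_sub]
      exact mul_nonneg hn (sub_nonneg.2 (max_le_max_right _ (by linarith)))
  · refine Finset.sum_le_sum fun n _ => ?_
    have hn : 0 ≤ ArithmeticFunction.vonMangoldt n := ArithmeticFunction.vonMangoldt_nonneg
    rw [← mul_sub]
    split_ifs with h
    · rw [max_eq_left (by linarith : (0 : ℝ) ≤ y - n), mul_comm (y - x)]
      exact mul_le_mul_of_nonneg_left (by linarith [le_max_left (x - n) 0]) hn
    · rw [max_eq_right (by linarith : y - (n : ℝ) ≤ 0), max_eq_right (by linarith), sub_zero,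
        mul_zero, mul_zero]

lemma exists_abs_mul_rieszVonMangoldt_inv_sub_le (k : ℕ) :
    ∃ C : ℝ, 0 ≤ C ∧ ∀ x, 1 < x →
      |x * rieszVonMangoldt x⁻¹ - x * (x - 1) / 2| ≤ C * (x ^ 2 / (Real.log x) ^ k) := by
  obtain ⟨C, hC⟩ := exists_abs_log_pow_mul_abs_rieszError_le k
  refine ⟨|C|, abs_nonneg C, fun x hx => ?_⟩
  have hx0 : 0 < x := by linarith
  have hlog : 0 < Real.log x := Real.log_pos hx
  have h := hC x⁻¹ (inv_pos.2 hx0)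
  rw [Real.log_inv, abs_neg, abs_of_pos hlog, inv_inv] at h
  have h1 : x * rieszVonMangoldt x⁻¹ - x * (x - 1) / 2 = x * rieszError x⁻¹ := by
    rw [rieszError, inv_inv, max_eq_left (by linarith)]
    ring
  rw [h1, abs_mul, abs_of_pos hx0, ← mul_div_assoc, le_div_iff₀ (by positivity)]
  calc x * |rieszError x⁻¹| * Real.log x ^ k
      = x * (Real.log x ^ k * |rieszError x⁻¹|) := by ring
    _ ≤ x * (C * x) := by gcongr
    _ ≤ x * (|C| * x) := by gcongr; exact le_abs_self C
    _ = _ := by ring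

lemma psi_sub_self_isBigO (m : ℕ) :
    (fun x : ℝ => Chebyshev.psi x - x) =O[atTop] fun x => x / (Real.log x) ^ (m + 1) := by
  obtain ⟨C, hC0, hC⟩ := exists_abs_mul_rieszVonMangoldt_inv_sub_le (2 * (m + 1))
  refine Asymptotics.IsBigO.of_bound (1 + C * (4 + 2 ^ (2 * (m + 1)))) ?_
  have hlog := Real.tendsto_log_atTop.eventually_ge_atTop 2
  have hpow := (Real.isLittleO_pow_log_id_atTop (n := m + 1)).bound (c := 1) one_pos
  filter_upwards [hlog, hpow, eventually_gt_atTop 1] with x hL hp hx1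
  have hx0 : 0 < x := by linarith
  set L := Real.log x with hLdef
  have hL0 : 0 < L := by linarith
  have hLm : 0 < L ^ (m + 1) := by positivity
  have hLm2 : 2 ≤ L ^ (m + 1) := hL.trans (le_self_pow₀ (by linarith) (by omega))
  rw [id, Real.norm_of_nonneg hLm.le, Real.norm_of_nonneg hx0.le, one_mul] at hp
  set h := x / L ^ (m + 1) with hh
  have hh0 : 0 < h := by positivity
  have hh1 : 1 ≤ h := (one_le_div hLm).2 hp
  have hhx : h ≤ x / 2 := by rw [hh]; gcongr
  have hx3 : 3 ≤ x := by linarith [Real.log_le_sub_one_of_pos hx0]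
  have hhh : x ^ 2 / L ^ (2 * (m + 1)) = h ^ 2 := by rw [hh, div_pow, ← pow_mul, mul_comm 2]
  have e0 := hC x hx1
  rw [← hLdef, hhh] at e0
  have e1 : |(x + h) * rieszVonMangoldt (x + h)⁻¹ - (x + h) * (x + h - 1) / 2|
      ≤ C * (4 * h ^ 2) := by
    refine (hC (x + h) (by linarith)).trans ?_
    gcongr
    have hlog1 : L ≤ Real.log (x + h) := Real.log_le_log hx0 (by linarith)
    calc (x + h) ^ 2 / Real.log (x + h) ^ (2 * (m + 1)) ≤ (2 * x) ^ 2 / L ^ (2 * (m + 1)) := by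
          gcongr
          linarith
      _ = _ := by rw [← hhh]; ring
  have e2 : |(x - h) * rieszVonMangoldt (x - h)⁻¹ - (x - h) * (x - h - 1) / 2|
      ≤ C * (2 ^ (2 * (m + 1)) * h ^ 2) := by
    refine (hC (x - h) (by linarith)).trans ?_
    gcongr
    have hlog1 : L / 2 ≤ Real.log (x - h) := by
      have h1 : Real.log (x / 2) ≤ Real.log (x - h) := Real.log_le_log (by linarith) (by linarith)
      rw [Real.log_div hx0.ne' two_ne_zero] at h1
      linarith [Real.log_two_lt_d9]
    calc (x - h) ^ 2 / Real.log (x - h) ^ (2 * (m + 1)) ≤ x ^ 2 / (L / 2) ^ (2 * (m + 1)) := by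
          gcongr <;> linarith
      _ = _ := by rw [← hhh, div_pow]; field_simp
  have f1 := (sub_mul_psi_le_and_le hx0 (show x ≤ x + h by linarith)).1
  have f2 := (sub_mul_psi_le_and_le (show 0 < x - h by linarith) (show x - h ≤ x by linarith)).2
  rw [add_sub_cancel_left] at f1
  rw [sub_sub_cancel] at f2
  rw [abs_le] at e0 e1 e2
  rw [Real.norm_eq_abs, Real.norm_of_nonneg hh0.le, abs_le]
  set Q : ℝ := 2 ^ (2 * (m + 1)) with hQ
  have hQ1 : 1 ≤ Q := one_le_pow₀ (by norm_num)
  have hCQ : 0 ≤ C * h ^ 2 * Q := by positivity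
  have hCh : 0 ≤ C * h ^ 2 := by positivity
  constructor
  · refine le_of_mul_le_mul_left ?_ hh0
    nlinarith [e0.1, e2.2, f2]
  · refine le_of_mul_le_mul_left ?_ hh0
    nlinarith [e0.2, e1.1, f1]

lemma theta_sub_self_isBigO (m : ℕ) :
    (fun x : ℝ => Chebyshev.theta x - x) =O[atTop] fun x => x / (Real.log x) ^ (m + 1) := by
  have h1 : Real.sqrt =O[atTop] fun x => x / (Real.log x) ^ (m + 1) := by
    refine Asymptotics.IsBigO.of_bound 1 ?_
    have hpow := (isLittleO_log_rpow_rpow_atTop ((m + 1 : ℕ) : ℝ) (show (0 : ℝ) < 1 / 2 by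
      norm_num)).bound (c := 1) one_pos
    filter_upwards [hpow, eventually_gt_atTop 1] with x hp hx
    have hL := Real.log_pos hx
    have hx0 : 0 < x := by linarith
    rw [Real.rpow_natCast, ← Real.sqrt_eq_rpow, Real.norm_of_nonneg (by positivity),
      Real.norm_of_nonneg (by positivity), one_mul] at hp
    rw [Real.norm_of_nonneg (by positivity), Real.norm_of_nonneg (by positivity), one_mul,
      le_div_iff₀ (by positivity)]
    calc √x * Real.log x ^ (m + 1) ≤ √x * √x := by gcongr
      _ = x := Real.mul_self_sqrt hx0.le
  have h2 := (psi_sub_self_isBigO m).sub (Chebyshev.isBigO_psi_sub_theta_sqrt.trans h1)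
  refine h2.congr_left fun x => ?_
  simp only [Pi.sub_apply]
  ring

lemma primeSumIoc_eq_sum {x b : ℝ} (hx : 0 ≤ x) (hb : 0 ≤ b) :
    primeSumIoc x b = ∑ n ∈ Finset.Ioc ⌊x⌋₊ ⌊b⌋₊,
      ((n : ℝ) * Real.log n)⁻¹ * if Nat.Prime n then Real.log n else 0 := by
  simp only [mul_ite, mul_zero]
  rw [← Finset.sum_filter, primeSumIoc]
  refine Finset.sum_congr ?_ fun n hn => ?_
  · ext n
    simp only [Finset.mem_filter, Finset.mem_range, Finset.mem_Ioc, Nat.floor_lt hx,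
      Nat.le_floor_iff hb, Nat.lt_succ_iff]
    tauto
  · have hp : Nat.Prime n := (Finset.mem_filter.1 hn).2
    have h1 : (1 : ℝ) < n := by exact_mod_cast hp.one_lt
    have h2 := Real.log_pos h1
    field_simp

lemma hasDerivAt_inv_mul_log {y : ℝ} (hy : 1 < y) :
    HasDerivAt (fun y => (y * Real.log y)⁻¹) (-(Real.log y + 1) / (y * Real.log y) ^ 2) y := by
  have h0 : y ≠ 0 := by linarith
  have hl := (Real.log_pos hy).ne'
  exact (Real.hasDerivAt_mul_log h0).fun_inv (mul_ne_zero h0 hl)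

lemma continuousOn_deriv_inv_mul_log {x b : ℝ} (hx : 1 < x) :
    ContinuousOn (fun y => -(Real.log y + 1) / (y * Real.log y) ^ 2) (Set.Icc x b) := by
  have h0 : ∀ y ∈ Set.Icc x b, y ≠ 0 := fun y hy => by linarith [hy.1]
  have hlog : ContinuousOn Real.log (Set.Icc x b) := Real.continuousOn_log.mono h0
  refine ContinuousOn.div (hlog.add continuousOn_const).neg ((continuousOn_id.mul hlog).pow 2) ?_
  intro y hy
  exact pow_ne_zero 2 (mul_ne_zero (h0 y hy) (Real.log_pos (hx.trans_le hy.1)).ne')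

/-- Abel summation for `∑ 1/p`, in terms of the error `θ(y) - y`. -/
lemma primeSumIoc_sub_log_log_eq {x b : ℝ} (hx : 1 < x) (hxb : x ≤ b) :
    primeSumIoc x b - (Real.log (Real.log b) - Real.log (Real.log x))
      = (b * Real.log b)⁻¹ * (Chebyshev.theta b - b)
        - (x * Real.log x)⁻¹ * (Chebyshev.theta x - x)
        - ∫ y in x..b, -(Real.log y + 1) / (y * Real.log y) ^ 2 * (Chebyshev.theta y - y) := by
  have hgt : ∀ y ∈ Set.Icc x b, 1 < y := fun y hy => hx.trans_le hy.1
  have hcont := continuousOn_deriv_inv_mul_log (b := b) hx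
  have hderiv : Set.EqOn (fun y => -(Real.log y + 1) / (y * Real.log y) ^ 2)
      (deriv fun y => (y * Real.log y)⁻¹) (Set.Icc x b) :=
    fun y hy => (hasDerivAt_inv_mul_log (hgt y hy)).deriv.symm
  have habel := sum_mul_eq_sub_sub_integral_mul
    (fun n : ℕ => if Nat.Prime n then Real.log n else 0) (f := fun y => (y * Real.log y)⁻¹)
    (by linarith) hxb (fun y hy => (hasDerivAt_inv_mul_log (hgt y hy)).differentiableAt)
    ((hcont.congr fun y hy => (hderiv hy).symm).integrableOn_Icc)
  simp only [← Finset.sum_filter, ← Chebyshev.theta_eq_sum_Icc] at habel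
  rw [← primeSumIoc_eq_sum (by linarith) (by linarith),
    ← MeasureTheory.setIntegral_congr_fun (g := fun y => deriv (fun y => (y * Real.log y)⁻¹) y *
      Chebyshev.theta y) (f := fun y => -(Real.log y + 1) / (y * Real.log y) ^ 2 *
      Chebyshev.theta y) measurableSet_Ioc
      (fun y hy => by simp only [← hderiv (Set.Ioc_subset_Icc_self hy)]),
    ← intervalIntegral.integral_of_le hxb] at habel
  rw [← Set.uIcc_of_le hxb] at hcont hgt
  have hmain : ∫ y in x..b, -(Real.log y + 1) / (y * Real.log y) ^ 2 * y
      = (b * (b * Real.log b)⁻¹ - Real.log (Real.log b))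
        - (x * (x * Real.log x)⁻¹ - Real.log (Real.log x)) := by
    refine intervalIntegral.integral_eq_sub_of_hasDerivAt
      (f := fun y => y * (y * Real.log y)⁻¹ - Real.log (Real.log y)) (fun y hy => ?_)
      (hcont.mul continuousOn_id).intervalIntegrable
    have h1 := hgt y hy
    have h0 : y ≠ 0 := by linarith
    have hl := (Real.log_pos h1).ne'
    have h2 := ((hasDerivAt_id y).mul (hasDerivAt_inv_mul_log h1)).sub
      ((Real.hasDerivAt_log hl).comp y (Real.hasDerivAt_log h0))
    refine HasDerivAt.congr_deriv h2 ?_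
    rw [id]
    field_simp
    ring
  have hsplit : ∫ y in x..b, -(Real.log y + 1) / (y * Real.log y) ^ 2 * (Chebyshev.theta y - y)
      = (∫ y in x..b, -(Real.log y + 1) / (y * Real.log y) ^ 2 * Chebyshev.theta y)
        - ∫ y in x..b, -(Real.log y + 1) / (y * Real.log y) ^ 2 * y := by
    rw [← intervalIntegral.integral_sub]
    · simp only [mul_sub]
    · exact Chebyshev.theta_mono.intervalIntegrable.continuousOn_mul hcont
    · exact (hcont.mul continuousOn_id).intervalIntegrable
  rw [habel, hsplit, hmain]
  ring

lemma primeSumIoc_sub_log_log_isBigO {a : ℝ} (ha : 1 < a) (m : ℕ) :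
    (fun x : ℝ => primeSumIoc x (a * x) - (Real.log (Real.log (a * x)) - Real.log (Real.log x)))
      =O[atTop] fun x => ((Real.log x) ^ m)⁻¹ := by
  obtain ⟨C, hC0, hC⟩ := (theta_sub_self_isBigO m).exists_nonneg
  obtain ⟨x₀, hx₀⟩ := eventually_atTop.1 hC.bound
  refine Asymptotics.IsBigO.of_bound (2 * C + 2 * C * (a - 1)) ?_
  filter_upwards [Real.tendsto_log_atTop.eventually_ge_atTop 1, eventually_ge_atTop x₀,
    eventually_gt_atTop 1] with x hL hx hx1
  have hxb : x ≤ a * x := by nlinarith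
  set L := Real.log x with hLdef
  have hL0 : 0 < L := by linarith
  have hθ : ∀ y, x ≤ y → |Chebyshev.theta y - y| ≤ C * (y / L ^ (m + 1)) := by
    intro y hy
    have hLy : L ≤ Real.log y := Real.log_le_log (by linarith) hy
    have h := hx₀ y (hx.trans hy)
    rw [Real.norm_eq_abs, Real.norm_of_nonneg
      (div_nonneg (by linarith) (pow_nonneg (by linarith) _))] at h
    refine h.trans ?_
    have : 0 ≤ y := by linarith
    gcongr
  have hLm : 0 < L ^ m := by positivity
  have hend : ∀ y, x ≤ y →
      |(y * Real.log y)⁻¹ * (Chebyshev.theta y - y)| ≤ C * (L ^ m)⁻¹ := by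
    intro y hy
    have hy0 : 0 < y := by linarith
    have hLy : L ≤ Real.log y := Real.log_le_log (by linarith) hy
    have hly0 : 0 < Real.log y := by linarith
    rw [abs_mul, abs_of_pos (by positivity)]
    calc _ ≤ (y * 1)⁻¹ * (C * (y / L ^ m)) := by
          gcongr
          · linarith
          · refine (hθ y hy).trans ?_
            gcongr
            omega
      _ = _ := by field_simp
  have hrem : ‖∫ y in x..a * x,
      -(Real.log y + 1) / (y * Real.log y) ^ 2 * (Chebyshev.theta y - y)‖
      ≤ 2 * C * (L ^ m)⁻¹ / x * |a * x - x| := by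
    refine intervalIntegral.norm_integral_le_of_norm_le_const fun y hy => ?_
    rw [Set.uIoc_of_le hxb] at hy
    have hy0 : 0 < y := by linarith [hy.1]
    have hLy : L ≤ Real.log y := Real.log_le_log (by linarith) hy.1.le
    have hly0 : 0 < Real.log y := by linarith
    have h1 : |-(Real.log y + 1) / (y * Real.log y) ^ 2| ≤ 2 / y ^ 2 := by
      rw [abs_div, abs_neg, abs_of_pos (by positivity), abs_of_pos (by positivity),
        div_le_div_iff₀ (by positivity) (by positivity), mul_pow]
      have h3 : Real.log y + 1 ≤ 2 * Real.log y ^ 2 := by nlinarith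
      calc (Real.log y + 1) * y ^ 2 ≤ (2 * Real.log y ^ 2) * y ^ 2 := by gcongr
        _ = _ := by ring
    rw [Real.norm_eq_abs, abs_mul]
    calc _ ≤ 2 / y ^ 2 * (C * (y / L ^ m)) := by
          gcongr
          refine (hθ y hy.1.le).trans ?_
          gcongr
          omega
      _ = 2 * C * (L ^ m)⁻¹ / y := by field_simp
      _ ≤ _ := by
          gcongr
          exact hy.1.le
  rw [primeSumIoc_sub_log_log_eq hx1 hxb, Real.norm_eq_abs, Real.norm_of_nonneg (by positivity)]
  have e1 := hend (a * x) hxb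
  have e2 := hend x le_rfl
  have e3 : 2 * C * (L ^ m)⁻¹ / x * |a * x - x| = 2 * C * (a - 1) * (L ^ m)⁻¹ := by
    rw [abs_of_nonneg (by linarith)]
    field_simp
  rw [e3, Real.norm_eq_abs] at hrem
  refine (abs_sub _ _).trans ?_
  have e4 := abs_sub ((a * x * Real.log (a * x))⁻¹ * (Chebyshev.theta (a * x) - a * x))
    ((x * Real.log x)⁻¹ * (Chebyshev.theta x - x))
  rw [add_mul]
  linarith

/-- For every real `a > 1` and every real `t`, one has
`∑_{x < p ≤ ax} 1/p − (log log(ax) − log log x) = O((log x)^{−t})` as `x → ∞`. -/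
theorem primeSum_Ioc_sub_loglog_bigO (a : ℝ) (ha : 1 < a) (t : ℝ) :
    (fun x : ℝ => primeSumIoc x (a * x) - (Real.log (Real.log (a * x)) - Real.log (Real.log x)))
      =O[atTop] fun x : ℝ => (Real.log x) ^ (-t) := by
  refine (primeSumIoc_sub_log_log_isBigO ha ⌈t⌉₊).trans (Asymptotics.IsBigO.of_bound 1 ?_)
  filter_upwards [Real.tendsto_log_atTop.eventually_ge_atTop 1] with x hL
  have hL0 : 0 < Real.log x := by linarith
  rw [one_mul, Real.norm_of_nonneg (by positivity), Real.norm_of_nonneg (by positivity),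
    ← Real.rpow_natCast, ← Real.rpow_neg hL0.le]
  exact Real.rpow_le_rpow_of_exponent_le hL (neg_le_neg (Nat.le_ceil t))
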